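/- arXiv:2602.04839 — 2 statements merged into one kernel-verified Lean document; each statement's English description precedes it below -/
import Mathlib

section
/- For every natural number n and every t ∈ [0, 1/2], the n-th iterate of g₁ satisfies g₁^[n](t) = 2ⁿ·t / (2·(2ⁿ − 1)·t + 1). -/
/-- The element `g₁` of the Lodha–Moore group as a piecewise fractional linear map. -/
noncomputable def g₁ (t : ℝ) : ℝ :=
  if t ≤ 0 then t
  else if t ≤ 1 / 2 then 2 * t / (2 * t + 1)
  else if t ≤ 1 then 1 / (3 - 2 * t)
  else t

theorem g₁_of_mem_Icc {t : ℝ} (ht : t ∈ Set.Icc (0 : ℝ) (1 / 2)) :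
    g₁ t = 2 * t / (2 * t + 1) := by
  obtain ⟨h0, h1⟩ := ht
  rcases h0.eq_or_lt with rfl | h0
  · simp [g₁]
  · rw [g₁, if_neg h0.not_ge, if_pos h1]

/-- Formula for the `n`-th iterate of `g₁` on `[0, 1/2]`. -/
theorem g₁_iterate_formula (n : ℕ) (t : ℝ) (ht : t ∈ Set.Icc (0 : ℝ) (1 / 2)) :
    g₁^[n] t = 2 ^ n * t / (2 * (2 ^ n - 1) * t + 1) := by
  have h0 : 0 ≤ t := ht.1
  have h1 : t ≤ 1 / 2 := ht.2
  induction n with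
  | zero => simp
  | succ n ih =>
    have ha : (1 : ℝ) ≤ 2 ^ n := one_le_pow₀ one_le_two
    have hd : 0 < 2 * (2 ^ n - 1) * t + 1 := by
      have := mul_nonneg (sub_nonneg.2 ha) h0
      linarith
    have hmem : 2 ^ n * t / (2 * (2 ^ n - 1) * t + 1) ∈ Set.Icc (0 : ℝ) (1 / 2) := by
      refine ⟨by positivity, ?_⟩
      rw [div_le_iff₀ hd]
      linarith
    rw [Function.iterate_succ_apply', ih, g₁_of_mem_Icc hmem, pow_succ]
    generalize (2 : ℝ) ^ n = a at *
    have hsum : 2 * (a * t / (2 * (a - 1) * t + 1)) + 1 =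
        (2 * (a * 2 - 1) * t + 1) / (2 * (a - 1) * t + 1) := by
      rw [eq_div_iff hd.ne', add_mul, mul_assoc, div_mul_cancel₀ _ hd.ne']
      ring
    rw [hsum, ← mul_div_assoc, div_div_div_cancel_right₀ hd.ne']
    ring
end

section
/- For every positive integer M and every t ∈ [M/(M+1), (M+1)/(M+2)], one has g₂^[M]( (t − 1) / ((M+4)·t − (M+3)) ) = t. (Equivalently, g₂^{−M}(t) = (t−1)/((M+4)t − (M+3)) on [M/(M+1), (M+1)/(M+2)].) -/
/-- The element `g₂` of the Lodha–Moore group as a piecewise fractional linear map. -/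
noncomputable def g₂ (t : ℝ) : ℝ :=
  if t ≤ 0 then t
  else if t ≤ 1 / 3 then t / (1 - t)
  else if t ≤ 1 / 2 then (4 * t - 1) / (5 * t - 1)
  else if t ≤ 1 then 1 / (2 - t)
  else t

/-- On `[1/3, 1/2]`, `g₂` is given by `t ↦ (4t − 1)/(5t − 1)`. -/
theorem g₂_of_mem_Icc_third_half {x : ℝ} (hx : x ∈ Set.Icc (1 / 3 : ℝ) (1 / 2)) :
    g₂ x = (4 * x - 1) / (5 * x - 1) := by
  obtain ⟨h₁, h₂⟩ := hx
  rw [g₂, if_neg (by linarith)]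
  split_ifs with h
  · obtain rfl : x = 1 / 3 := le_antisymm h h₁
    norm_num
  · rfl

/-- On `[1/2, 1]`, `g₂` is given by `t ↦ 1/(2 − t)`. -/
theorem g₂_of_mem_Icc_half_one {x : ℝ} (hx : x ∈ Set.Icc (1 / 2 : ℝ) 1) :
    g₂ x = 1 / (2 - x) := by
  obtain ⟨h₁, h₂⟩ := hx
  rw [g₂, if_neg (by linarith), if_neg (by linarith), if_pos h₂]
  split_ifs with h
  · obtain rfl : x = 1 / 2 := le_antisymm h h₁
    norm_num
  · rfl

/-- On `[M/(M+1), (M+1)/(M+2)]`, the inverse of `g₂^[M]` is given by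
`t ↦ (t − 1)/((M+4)t − (M+3))`. -/
theorem g₂_inv_iterate_formula₁ (M : ℕ) (hM : 0 < M) (t : ℝ)
    (ht : t ∈ Set.Icc ((M : ℝ) / ((M : ℝ) + 1)) (((M : ℝ) + 1) / ((M : ℝ) + 2))) :
    g₂^[M] ((t - 1) / (((M : ℝ) + 4) * t - ((M : ℝ) + 3))) = t := by
  induction M, hM using Nat.le_induction generalizing t with
  | base =>
    obtain ⟨h₁, h₂⟩ := ht
    norm_num at h₁ h₂
    have hd : 0 < 4 - 5 * t := by linarith
    have hd₀ : 4 - 5 * t ≠ 0 := hd.ne'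
    have hx : (t - 1) / (((1 : ℕ) + 4 : ℝ) * t - ((1 : ℕ) + 3)) = (1 - t) / (4 - 5 * t) := by
      rw [← neg_div_neg_eq]
      congr 1 <;> push_cast <;> ring
    rw [Function.iterate_one, hx, g₂_of_mem_Icc_third_half]
    · have hn : 4 * ((1 - t) / (4 - 5 * t)) - 1 = t / (4 - 5 * t) := by
        rw [eq_div_iff hd₀, sub_mul, mul_assoc, div_mul_cancel₀ _ hd₀]
        ring
      have hm : 5 * ((1 - t) / (4 - 5 * t)) - 1 = 1 / (4 - 5 * t) := by
        rw [eq_div_iff hd₀, sub_mul, mul_assoc, div_mul_cancel₀ _ hd₀]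
        ring
      rw [hn, hm, div_div_div_cancel_right₀ hd₀, div_one]
    · constructor
      · rw [le_div_iff₀ hd]
        linarith
      · rw [div_le_iff₀ hd]
        linarith
  | succ M hM ih =>
    obtain ⟨h₁, h₂⟩ := ht
    have hM' : (1 : ℝ) ≤ M := by exact_mod_cast hM
    push_cast at h₁ h₂ ⊢
    rw [div_le_iff₀ (by linarith)] at h₁
    rw [le_div_iff₀ (by linarith)] at h₂
    have ht : 0 < t := by nlinarith
    have hs : 2 - 1 / t = (2 * t - 1) / t := by field_simp
    have hx : (t - 1) / ((M + 1 + 4) * t - (M + 1 + 3)) =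
        (2 - 1 / t - 1) / ((M + 4) * (2 - 1 / t) - (M + 3)) := by
      rw [← mul_div_mul_right (2 - 1 / t - 1) _ ht.ne']
      congr 1 <;> field_simp <;> ring
    rw [Function.iterate_succ_apply', hx, ih (2 - 1 / t), g₂_of_mem_Icc_half_one]
    · rw [sub_sub_cancel, one_div_one_div]
    · rw [hs]
      constructor
      · rw [le_div_iff₀ ht]
        nlinarith
      · rw [div_le_iff₀ ht]
        nlinarith
    · rw [hs]
      constructor
      · rw [div_le_div_iff₀ (by linarith) ht]
        linarith
      · rw [div_le_div_iff₀ ht (by linarith)]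
        linarith
end
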